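/- For an observation system on a bipartite graph G=(V,F,E), the conditional entropy H(X | Y, Z(θ)) is twice differentiable in θ and satisfies the identity d²/dθ² H(X | Y, Z(θ)) = Σ_{i≠j∈V} I(X_i ; X_j | Y, Z^{(ij)}(θ)), where Z^{(U)}(θ) denotes the observation vector obtained from Z(θ) by replacing Z_i(θ) with (Z_i, ∗) for every i ∈ U, and I denotes conditional mutual information. -/

import Mathlib

open Finset MeasureTheory Filter

namespace PaperObs

/-- Reveal-perturbation factor for the perturbed observation `Z_i(θ)`:
`Z_i(θ) = (Z_i, X_i)` with probability `θ` and `(Z_i, ∗)` with probability `1-θ`,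
where `∗` is encoded by `Option.none`. -/
def pert {𝒳 : Type*} [DecidableEq 𝒳] (θ : ℝ) (o : Option 𝒳) (x : 𝒳) : ℝ :=
  if o = some x then θ else if o = none then 1 - θ else 0

section Core

variable {V F 𝒳 𝒴 𝒵 : Type*} [Fintype V] [Fintype F] [Fintype 𝒳] [Fintype 𝒴] [Fintype 𝒵]
  [DecidableEq V] [DecidableEq F] [DecidableEq 𝒳] [DecidableEq 𝒴]

/-- Joint density of `(X, Y_{S_F}, Z_{S_V}(θ))` in an observation system, where only the
observations `Y_a`, `a ∈ SF`, and `Z_i(θᵥ i)`, `i ∈ SV`, are kept (the others being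
marginalized out), and where the perturbation parameter is allowed to depend on the node. -/
def jointSub (p : 𝒳 → ℝ) (Q : F → 𝒴 → (V → 𝒳) → ℝ) (R : 𝒵 → 𝒳 → ℝ) (θv : V → ℝ)
    (SF : Finset F) (SV : Finset V)
    (x : V → 𝒳) (y : F → 𝒴) (z : V → 𝒵 × Option 𝒳) : ℝ :=
  (∏ i, p (x i)) * (∏ a ∈ SF, Q a (y a) x) *
    ∏ i ∈ SV, (R (z i).1 (x i) * pert (θv i) (z i).2 (x i))

/-- Conditional probability `P{X_{i(1)} = ξ₁, …, X_{i(k)} = ξ_k | Y_{SF}, Z_{SV}(θ)}`. -/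
noncomputable def condPTuple (p : 𝒳 → ℝ) (Q : F → 𝒴 → (V → 𝒳) → ℝ) (R : 𝒵 → 𝒳 → ℝ)
    (θv : V → ℝ) (SF : Finset F) (SV : Finset V) {k : ℕ} (ii : Fin k → V) (ξ : Fin k → 𝒳)
    (y : F → 𝒴) (z : V → 𝒵 × Option 𝒳) : ℝ :=
  (∑ x : V → 𝒳, if ∀ l, x (ii l) = ξ l then jointSub p Q R θv SF SV x y z else 0) /
    ∑ x : V → 𝒳, jointSub p Q R θv SF SV x y z

/-- Conditional probability `P{X_U = ξ_U | Y_{SF}, Z_{SV}(θ)}` for a set `U` of variable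
nodes. -/
noncomputable def condPOn (p : 𝒳 → ℝ) (Q : F → 𝒴 → (V → 𝒳) → ℝ) (R : 𝒵 → 𝒳 → ℝ)
    (θv : V → ℝ) (SF : Finset F) (SV : Finset V) (U : Finset V) (ξ : {v // v ∈ U} → 𝒳)
    (y : F → 𝒴) (z : V → 𝒵 × Option 𝒳) : ℝ :=
  (∑ x : V → 𝒳, if ∀ l : {v // v ∈ U}, x l.1 = ξ l then jointSub p Q R θv SF SV x y z else 0) /
    ∑ x : V → 𝒳, jointSub p Q R θv SF SV x y z

/-- One-variable conditional marginal `P{X_i = ξ | Y_{SF}, Z_{SV}(θ)}`. -/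
noncomputable def margP (p : 𝒳 → ℝ) (Q : F → 𝒴 → (V → 𝒳) → ℝ) (R : 𝒵 → 𝒳 → ℝ)
    (θv : V → ℝ) (SF : Finset F) (SV : Finset V) (i : V) (ξ : 𝒳)
    (y : F → 𝒴) (z : V → 𝒵 × Option 𝒳) : ℝ :=
  condPTuple p Q R θv SF SV (fun _ : Fin 1 => i) (fun _ => ξ) y z

/-- Total variation distance between the joint conditional law of
`(X_{i(1)}, …, X_{i(k)})` given the observations and the product of its marginals. -/
noncomputable def tvTuple (p : 𝒳 → ℝ) (Q : F → 𝒴 → (V → 𝒳) → ℝ) (R : 𝒵 → 𝒳 → ℝ)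
    (θv : V → ℝ) (SF : Finset F) (SV : Finset V) {k : ℕ} (ii : Fin k → V)
    (y : F → 𝒴) (z : V → 𝒵 × Option 𝒳) : ℝ :=
  2⁻¹ * ∑ ξ : Fin k → 𝒳,
    |condPTuple p Q R θv SF SV ii ξ y z - ∏ l, margP p Q R θv SF SV (ii l) (ξ l) y z|

/-- Total variation distance between the joint conditional law of `X_U` given the
observations and the product of its marginals. -/
noncomputable def tvOn (p : 𝒳 → ℝ) (Q : F → 𝒴 → (V → 𝒳) → ℝ) (R : 𝒵 → 𝒳 → ℝ)
    (θv : V → ℝ) (SF : Finset F) (SV : Finset V) (U : Finset V)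
    (y : F → 𝒴) (z : V → 𝒵 × Option 𝒳) : ℝ :=
  2⁻¹ * ∑ ξ : {v // v ∈ U} → 𝒳,
    |condPOn p Q R θv SF SV U ξ y z - ∏ l : {v // v ∈ U}, margP p Q R θv SF SV l.1 (ξ l) y z|

/-- Expectation, over the observations `(Y, Z(θ))`, of a function `f` of the observations. -/
noncomputable def expObs (p : 𝒳 → ℝ) (Q : F → 𝒴 → (V → 𝒳) → ℝ) (R : 𝒵 → 𝒳 → ℝ)
    (θv : V → ℝ) (f : (F → 𝒴) → (V → 𝒵 × Option 𝒳) → ℝ) : ℝ :=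
  ∑ y : F → 𝒴, ∑ z : V → 𝒵 × Option 𝒳,
    (∑ x : V → 𝒳, jointSub p Q R θv univ univ x y z) * f y z

/-- Shannon entropy `H(X₁)` of a single variable with law `p`. -/
noncomputable def Hp (p : 𝒳 → ℝ) : ℝ := ∑ x, Real.negMulLog (p x)

/-- Conditional Shannon entropy `H(X | Y, Z(θ))` of the full hidden vector given
the observations, computed as `H(X, (Y,Z(θ))) - H(Y, Z(θ))`. -/
noncomputable def condEnt (p : 𝒳 → ℝ) (Q : F → 𝒴 → (V → 𝒳) → ℝ) (R : 𝒵 → 𝒳 → ℝ)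
    (θv : V → ℝ) : ℝ :=
  (∑ x : V → 𝒳, ∑ y : F → 𝒴, ∑ z : V → 𝒵 × Option 𝒳,
      Real.negMulLog (jointSub p Q R θv univ univ x y z)) -
    ∑ y : F → 𝒴, ∑ z : V → 𝒵 × Option 𝒳,
      Real.negMulLog (∑ x : V → 𝒳, jointSub p Q R θv univ univ x y z)

/-- Conditional Shannon entropy `H(X_i | Y, Z(θ))` of a single variable given the
observations. -/
noncomputable def condEnt1 (p : 𝒳 → ℝ) (Q : F → 𝒴 → (V → 𝒳) → ℝ) (R : 𝒵 → 𝒳 → ℝ)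
    (θv : V → ℝ) (i : V) : ℝ :=
  (∑ ξ : 𝒳, ∑ y : F → 𝒴, ∑ z : V → 𝒵 × Option 𝒳,
      Real.negMulLog (∑ x : V → 𝒳, if x i = ξ then jointSub p Q R θv univ univ x y z else 0)) -
    ∑ y : F → 𝒴, ∑ z : V → 𝒵 × Option 𝒳,
      Real.negMulLog (∑ x : V → 𝒳, jointSub p Q R θv univ univ x y z)

/-- Conditional mutual information `I(X_i ; X_j | Y, Z(θ))`. -/
noncomputable def condMI (p : 𝒳 → ℝ) (Q : F → 𝒴 → (V → 𝒳) → ℝ) (R : 𝒵 → 𝒳 → ℝ)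
    (θv : V → ℝ) (i j : V) : ℝ :=
  ∑ y : F → 𝒴, ∑ z : V → 𝒵 × Option 𝒳, ∑ ξ₁ : 𝒳, ∑ ξ₂ : 𝒳,
    (∑ x : V → 𝒳, if x i = ξ₁ ∧ x j = ξ₂ then jointSub p Q R θv univ univ x y z else 0) *
      Real.log
        (((∑ x : V → 𝒳, if x i = ξ₁ ∧ x j = ξ₂ then jointSub p Q R θv univ univ x y z else 0) *
            ∑ x : V → 𝒳, jointSub p Q R θv univ univ x y z) /
          ((∑ x : V → 𝒳, if x i = ξ₁ then jointSub p Q R θv univ univ x y z else 0) *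
            ∑ x : V → 𝒳, if x j = ξ₂ then jointSub p Q R θv univ univ x y z else 0))

/-- `p` is a probability distribution on the finite alphabet `𝒳`. -/
def IsPdist (p : 𝒳 → ℝ) : Prop := (∀ x, 0 ≤ p x) ∧ ∑ x, p x = 1

/-- The function-node observation kernels are genuine probability kernels. -/
def IsKernelQ (Q : F → 𝒴 → (V → 𝒳) → ℝ) : Prop :=
  (∀ a y x, 0 ≤ Q a y x) ∧ ∀ a x, ∑ y, Q a y x = 1

/-- The single-variable observation kernel is a genuine probability kernel. -/
def IsKernelR (R : 𝒵 → 𝒳 → ℝ) : Prop :=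
  (∀ z x, 0 ≤ R z x) ∧ ∀ x, ∑ z, R z x = 1

/-- Neighborhood `∂a` of a function node in the bipartite graph `g`. -/
def nbr (g : V → F → Bool) (a : F) : Finset V := univ.filter fun i => g i a = true

/-- `Y_a` depends on `X` only through `X_{∂a}`. -/
def QLocal (g : V → F → Bool) (Q : F → 𝒴 → (V → 𝒳) → ℝ) : Prop :=
  ∀ a y x x', (∀ i ∈ nbr g a, x i = x' i) → Q a y x = Q a y x'

/-- The kernel of `Y_a` is invariant under permutations of its arguments `x_{∂a}`. -/
def QSym (g : V → F → Bool) (Q : F → 𝒴 → (V → 𝒳) → ℝ) : Prop :=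
  ∀ a y (x : V → 𝒳) (σ : Equiv.Perm V), (∀ i, g i a = g (σ i) a) → Q a y (x ∘ σ) = Q a y x

/-- A probability kernel `T` (with finite output alphabet `𝒜`) from `β` is `M`-soft:
mutual absolute continuity of the rows together with the bound
`∑_y (T(y|x₁)/T(y|x₂)) T(y|x) ≤ M`. -/
def SoftKer {𝒜 β : Type*} [Fintype 𝒜] (M : ℝ) (T : 𝒜 → β → ℝ) : Prop :=
  (∀ y x₁ x₂, T y x₂ = 0 → T y x₁ = 0) ∧
    ∀ x x₁ x₂, ∑ y, T y x₁ / T y x₂ * T y x ≤ M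

/-- Weight of the bipartite graph `g` in the ensemble where each edge is present
independently with probability `pe`. -/
def gW (pe : ℝ) (g : V → F → Bool) : ℝ := ∏ i, ∏ a, if g i a then pe else 1 - pe

/-- Expectation over the random bipartite graph with iid edges of probability `pe`. -/
noncomputable def expG (pe : ℝ) (f : (V → F → Bool) → ℝ) : ℝ :=
  ∑ g : V → F → Bool, gW pe g * f g

/-- A degree-indexed family of observation kernels `Q^{(k)}(·|x_1,…,x_k)`:
nonnegative, normalized, and invariant under permutations of the arguments. -/
def IsQFam (Qf : ∀ k : ℕ, 𝒴 → (Fin k → 𝒳) → ℝ) : Prop :=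
  (∀ k y v, 0 ≤ Qf k y v) ∧ (∀ k v, ∑ y, Qf k y v = 1) ∧
    ∀ k y (v : Fin k → 𝒳) (σ : Equiv.Perm (Fin k)), Qf k y (v ∘ σ) = Qf k y v

/-- The kernel of the observation `Y_a` induced on the graph `g` by the degree-indexed
family `Qf`: it is `Q^{(|∂a|)}` applied to `x_{∂a}`. -/
def QG [LinearOrder V] (Qf : ∀ k : ℕ, 𝒴 → (Fin k → 𝒳) → ℝ) (g : V → F → Bool) (a : F)
    (y : 𝒴) (x : V → 𝒳) : ℝ :=
  Qf ((nbr g a).sort (· ≤ ·)).length y fun l => x (((nbr g a).sort (· ≤ ·)).get l)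

/-- Variable nodes within (graph) distance `t` of the variable node `i`, where distance
is measured by the number of function nodes traversed. -/
def varBall (g : V → F → Bool) (i : V) : ℕ → Finset V
  | 0 => {i}
  | t+1 => varBall g i t ∪
      univ.filter fun j => ∃ a, g j a = true ∧ ∃ k ∈ varBall g i t, g k a = true

/-- Function nodes of the radius-`t` neighbourhood of `i`: those adjacent to a variable
node at distance at most `t - 1` from `i`. -/
def funBall (g : V → F → Bool) (i : V) : ℕ → Finset F
  | 0 => ∅
  | t+1 => univ.filter fun a => ∃ j ∈ varBall g i t, g j a = true

end Core

end PaperObs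
namespace PaperObs

section Helpers

variable {V F 𝒳 𝒴 𝒵 : Type*}

/-- Probability weight of the reveal pattern `o` at perturbation parameter `t`. -/
def revealWeight (t : ℝ) (o : Option 𝒳) : ℝ := o.elim (1 - t) fun _ => t

/-- Derivative of `revealWeight` in the perturbation parameter. -/
def revealSign (o : Option 𝒳) : ℝ := o.elim (-1) fun _ => 1

/-- Restriction of a density on `V → 𝒳` to the configurations compatible with the
revealed value `o` at the node `i`. -/
def restrictAt [DecidableEq 𝒳] (i : V) (o : Option 𝒳) (f : (V → 𝒳) → ℝ) (x : V → 𝒳) : ℝ :=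
  if o = none ∨ o = some (x i) then f x else 0

/-- Unnormalized entropy of a nonnegative weight on a finite type. -/
noncomputable def entropyGap {α : Type*} [Fintype α] (f : α → ℝ) : ℝ :=
  ∑ x, Real.negMulLog (f x) - Real.negMulLog (∑ x, f x)

lemma entropyGap_const_mul {α : Type*} [Fintype α] (c : ℝ) (f : α → ℝ) :
    entropyGap (fun x => c * f x) = c * entropyGap f := by
  simp only [entropyGap, ← Finset.mul_sum, Real.negMulLog_mul, Finset.sum_add_distrib,
    ← Finset.sum_mul]
  ring

lemma hasDerivAt_revealWeight (o : Option 𝒳) (t : ℝ) :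
    HasDerivAt (fun t => revealWeight t o) (revealSign o) t := by
  cases o with
  | none => simpa [revealWeight, revealSign] using (hasDerivAt_id t).const_sub 1
  | some a => simpa [revealWeight, revealSign] using hasDerivAt_id' t

lemma hasDerivAt_prod_revealWeight [DecidableEq V] (s : Finset V) (o : V → Option 𝒳) (t : ℝ) :
    HasDerivAt (fun t => ∏ i ∈ s, revealWeight t (o i))
      (∑ i ∈ s, revealSign (o i) * ∏ j ∈ s.erase i, revealWeight t (o j)) t := by
  have h := HasDerivAt.fun_finsetProd (u := s) (x := t)
    fun i _ => hasDerivAt_revealWeight (o i) t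
  simpa only [smul_eq_mul, mul_comm] using h

lemma sum_eq_sum_update_option [Fintype V] [DecidableEq V] [Fintype 𝒳] [DecidableEq 𝒳]
    [Fintype 𝒵] (i : V) (h : (V → 𝒵 × Option 𝒳) → ℝ) :
    ∑ z, h z = ∑ z : V → 𝒵 × Option 𝒳, if (z i).2 = none then
      ∑ o : Option 𝒳, h (Function.update z i ((z i).1, o)) else 0 := by
  rw [← Finset.sum_filter, ← Finset.sum_product']
  refine Finset.sum_bij' (fun z _ => (Function.update z i ((z i).1, none), (z i).2))
    (fun q _ => Function.update q.1 i ((q.1 i).1, q.2)) ?_ ?_ ?_ ?_ ?_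
  · simp
  · simp
  · simp
  · rintro ⟨z, o⟩ hz
    have hz : (z i).2 = none := by simpa using hz
    ext1
    · simp [← hz]
    · simp
  · simp

lemma ite_ite_and [DecidableEq 𝒳] (i j : V) (ξ₁ ξ₂ : 𝒳) (f : (V → 𝒳) → ℝ) (x : V → 𝒳) :
    (if x j = ξ₂ then if x i = ξ₁ then f x else 0 else 0) =
      if x i = ξ₁ ∧ x j = ξ₂ then f x else 0 := by
  split_ifs <;> simp_all

lemma restrictAt_none [DecidableEq 𝒳] (i : V) (f : (V → 𝒳) → ℝ) : restrictAt i none f = f := by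
  ext; simp [restrictAt]

lemma restrictAt_some [DecidableEq 𝒳] (i : V) (ξ : 𝒳) (f : (V → 𝒳) → ℝ) :
    restrictAt i (some ξ) f = fun x => if x i = ξ then f x else 0 := by
  ext; simp [restrictAt, eq_comm]

section MutualInformation

variable [Fintype V] [DecidableEq V] [Fintype 𝒳] [DecidableEq 𝒳]

lemma sum_sum_ite_eq (i : V) (f : (V → 𝒳) → ℝ) :
    ∑ ξ, ∑ x, (if x i = ξ then f x else 0) = ∑ x, f x := by
  rw [Finset.sum_comm]; simp

lemma sum_sum_ite_and_left (i j : V) (ξ₁ : 𝒳) (f : (V → 𝒳) → ℝ) :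
    ∑ ξ₂, ∑ x, (if x i = ξ₁ ∧ x j = ξ₂ then f x else 0) =
      ∑ x, if x i = ξ₁ then f x else 0 := by
  simp only [← ite_ite_and]
  exact sum_sum_ite_eq j _

lemma sum_sum_ite_and_right (i j : V) (ξ₂ : 𝒳) (f : (V → 𝒳) → ℝ) :
    ∑ ξ₁, ∑ x, (if x i = ξ₁ ∧ x j = ξ₂ then f x else 0) =
      ∑ x, if x j = ξ₂ then f x else 0 := by
  simp only [and_comm (a := _ = _) (b := _ = ξ₂)]
  exact sum_sum_ite_and_left j i ξ₂ f

/-- Mutual information of the `i`-th and `j`-th coordinates under a (possibly unnormalized)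
weight on `V → 𝒳`. -/
noncomputable def pairMI (f : (V → 𝒳) → ℝ) (i j : V) : ℝ :=
  ∑ ξ₁ : 𝒳, ∑ ξ₂ : 𝒳, (∑ x : V → 𝒳, if x i = ξ₁ ∧ x j = ξ₂ then f x else 0) *
    Real.log (((∑ x : V → 𝒳, if x i = ξ₁ ∧ x j = ξ₂ then f x else 0) * ∑ x : V → 𝒳, f x) /
      ((∑ x : V → 𝒳, if x i = ξ₁ then f x else 0) * ∑ x : V → 𝒳, if x j = ξ₂ then f x else 0))

lemma pairMI_const_mul (c : ℝ) (f : (V → 𝒳) → ℝ) (i j : V) :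
    pairMI (fun x => c * f x) i j = c * pairMI f i j := by
  rcases eq_or_ne c 0 with rfl | hc
  · simp [pairMI]
  simp only [pairMI, ← mul_ite_zero, ← Finset.mul_sum]
  simp only [Finset.mul_sum (s := (Finset.univ : Finset 𝒳)), mul_assoc c]
  refine Finset.sum_congr rfl fun ξ₁ _ => Finset.sum_congr rfl fun ξ₂ _ => ?_
  congr 3
  rw [mul_div_mul_left _ _ hc, mul_left_comm _ c, mul_left_comm _ c, mul_div_mul_left _ _ hc]

lemma pairMI_eq_negMulLog {f : (V → 𝒳) → ℝ} (hf : ∀ x, 0 ≤ f x) (i j : V) :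
    pairMI f i j =
      ∑ ξ₁, Real.negMulLog (∑ x, if x i = ξ₁ then f x else 0) +
      ∑ ξ₂, Real.negMulLog (∑ x, if x j = ξ₂ then f x else 0) -
      Real.negMulLog (∑ x, f x) -
      ∑ ξ₁, ∑ ξ₂, Real.negMulLog (∑ x, if x i = ξ₁ ∧ x j = ξ₂ then f x else 0) := by
  have hterm : ∀ ξ₁ ξ₂,
      (∑ x : V → 𝒳, if x i = ξ₁ ∧ x j = ξ₂ then f x else 0) *
        Real.log (((∑ x : V → 𝒳, if x i = ξ₁ ∧ x j = ξ₂ then f x else 0) * ∑ x : V → 𝒳, f x) /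
          ((∑ x : V → 𝒳, if x i = ξ₁ then f x else 0) *
            ∑ x : V → 𝒳, if x j = ξ₂ then f x else 0)) =
      (∑ x, if x i = ξ₁ ∧ x j = ξ₂ then f x else 0) * Real.log (∑ x, f x) -
      (∑ x, if x i = ξ₁ ∧ x j = ξ₂ then f x else 0) *
        Real.log (∑ x, if x i = ξ₁ then f x else 0) -
      (∑ x, if x i = ξ₁ ∧ x j = ξ₂ then f x else 0) *
        Real.log (∑ x, if x j = ξ₂ then f x else 0) -
      Real.negMulLog (∑ x, if x i = ξ₁ ∧ x j = ξ₂ then f x else 0) := by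
    intro ξ₁ ξ₂
    have h0 : 0 ≤ ∑ x : V → 𝒳, if x i = ξ₁ ∧ x j = ξ₂ then f x else 0 :=
      Finset.sum_nonneg fun x _ => by split_ifs <;> simp [hf]
    have h1 : (∑ x : V → 𝒳, if x i = ξ₁ ∧ x j = ξ₂ then f x else 0) ≤
        ∑ x, if x i = ξ₁ then f x else 0 :=
      Finset.sum_le_sum fun x _ => by split_ifs <;> simp_all
    have h2 : (∑ x : V → 𝒳, if x i = ξ₁ ∧ x j = ξ₂ then f x else 0) ≤
        ∑ x, if x j = ξ₂ then f x else 0 :=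
      Finset.sum_le_sum fun x _ => by split_ifs <;> simp_all
    have h3 : (∑ x : V → 𝒳, if x i = ξ₁ ∧ x j = ξ₂ then f x else 0) ≤ ∑ x, f x :=
      Finset.sum_le_sum fun x _ => by split_ifs <;> simp_all
    rcases h0.eq_or_lt with h | h
    · simp [← h]
    · have h1' := (h.trans_le h1).ne'
      have h2' := (h.trans_le h2).ne'
      have h3' := (h.trans_le h3).ne'
      rw [Real.log_div (mul_ne_zero h.ne' h3') (mul_ne_zero h1' h2'),
        Real.log_mul h.ne' h3', Real.log_mul h1' h2', Real.negMulLog]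
      ring
  have hi : ∑ ξ₁, ∑ ξ₂, (∑ x, if x i = ξ₁ ∧ x j = ξ₂ then f x else 0) *
      Real.log (∑ x, if x i = ξ₁ then f x else 0) =
      -∑ ξ₁, Real.negMulLog (∑ x, if x i = ξ₁ then f x else 0) := by
    simp only [← Finset.sum_mul, sum_sum_ite_and_left, Real.negMulLog, neg_mul,
      Finset.sum_neg_distrib, neg_neg]
  have hj : ∑ ξ₁, ∑ ξ₂, (∑ x, if x i = ξ₁ ∧ x j = ξ₂ then f x else 0) *
      Real.log (∑ x, if x j = ξ₂ then f x else 0) =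
      -∑ ξ₂, Real.negMulLog (∑ x, if x j = ξ₂ then f x else 0) := by
    rw [Finset.sum_comm]
    simp only [← Finset.sum_mul, sum_sum_ite_and_right, Real.negMulLog, neg_mul,
      Finset.sum_neg_distrib, neg_neg]
  have ht : ∑ ξ₁, ∑ ξ₂, (∑ x, if x i = ξ₁ ∧ x j = ξ₂ then f x else 0) *
      Real.log (∑ x, f x) = -Real.negMulLog (∑ x, f x) := by
    simp only [← Finset.sum_mul, sum_sum_ite_and_left, sum_sum_ite_eq, Real.negMulLog, neg_mul,
      neg_neg]
  simp only [pairMI, hterm, Finset.sum_sub_distrib, hi, hj, ht]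
  ring

lemma sum_revealSign_entropyGap_restrictAt {f : (V → 𝒳) → ℝ} (hf : ∀ x, 0 ≤ f x) (i j : V) :
    ∑ a : Option 𝒳, ∑ b : Option 𝒳, revealSign a * revealSign b *
      entropyGap (restrictAt j b (restrictAt i a f)) = pairMI f i j := by
  have hη : ∀ (i : V) (f : (V → 𝒳) → ℝ),
      ∑ ξ, ∑ x, Real.negMulLog (if x i = ξ then f x else 0) = ∑ x, Real.negMulLog (f x) := by
    intro i f
    simp only [apply_ite Real.negMulLog, Real.negMulLog_zero, sum_sum_ite_eq]
  rw [pairMI_eq_negMulLog hf]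
  simp only [Fintype.sum_option, restrictAt_none, restrictAt_some, entropyGap, revealSign,
    Option.elim, ite_ite_and, Finset.sum_add_distrib, Finset.sum_sub_distrib, mul_sub,
    ← Finset.mul_sum, hη]
  ring

end MutualInformation

section Observation

/-- Joint density of `(X, Y, Z(θ))` stripped of the probability of the reveal pattern. -/
def strippedJoint [Fintype V] [Fintype F] [DecidableEq 𝒳]
    (p : 𝒳 → ℝ) (Q : F → 𝒴 → (V → 𝒳) → ℝ) (R : 𝒵 → 𝒳 → ℝ)
    (y : F → 𝒴) (z : V → 𝒵 × Option 𝒳) (x : V → 𝒳) : ℝ :=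
  (∏ i, p (x i)) * (∏ a, Q a (y a) x) *
    ∏ i, (if (z i).2 = none ∨ (z i).2 = some (x i) then R (z i).1 (x i) else 0)

lemma strippedJoint_nonneg [Fintype V] [Fintype F] [DecidableEq 𝒳]
    {p : 𝒳 → ℝ} {Q : F → 𝒴 → (V → 𝒳) → ℝ} {R : 𝒵 → 𝒳 → ℝ}
    (hp : ∀ x, 0 ≤ p x) (hQ : ∀ a y x, 0 ≤ Q a y x) (hR : ∀ z x, 0 ≤ R z x)
    (y : F → 𝒴) (z : V → 𝒵 × Option 𝒳) (x : V → 𝒳) : 0 ≤ strippedJoint p Q R y z x := by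
  refine mul_nonneg (mul_nonneg (Finset.prod_nonneg fun _ _ => hp _)
    (Finset.prod_nonneg fun _ _ => hQ _ _ _)) (Finset.prod_nonneg fun _ _ => ?_)
  split_ifs <;> simp [hR]

lemma strippedJoint_update [Fintype V] [Fintype F] [DecidableEq V] [DecidableEq 𝒳]
    (p : 𝒳 → ℝ) (Q : F → 𝒴 → (V → 𝒳) → ℝ) (R : 𝒵 → 𝒳 → ℝ) (y : F → 𝒴)
    {z : V → 𝒵 × Option 𝒳} {i : V}
    (hz : (z i).2 = none) (o : Option 𝒳) :
    strippedJoint p Q R y (Function.update z i ((z i).1, o)) =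
      restrictAt i o (strippedJoint p Q R y z) := by
  ext x
  simp only [restrictAt, strippedJoint, ← Finset.mul_prod_erase _ _ (Finset.mem_univ i)]
  have h : ∀ c : V → 𝒵 × Option 𝒳 → ℝ,
      ∏ k ∈ univ.erase i, c k (Function.update z i ((z i).1, o) k) =
        ∏ k ∈ univ.erase i, c k (z k) := fun c => Finset.prod_congr rfl fun k hk => by
    rw [Function.update_of_ne (Finset.ne_of_mem_erase hk)]
  rw [h fun k q => if q.2 = none ∨ q.2 = some (x k) then R q.1 (x k) else 0]
  by_cases ho : o = none ∨ o = some (x i) <;> simp [ho, hz]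

lemma prod_revealWeight_hidden [Fintype V] [DecidableEq V] {i j : V} (hij : j ≠ i) (θ : ℝ)
    (o : V → Option 𝒳) :
    ∏ k, revealWeight (if k = i ∨ k = j then 0 else θ) (o k) =
      if o i = none then if o j = none then
        ∏ k ∈ (univ.erase i).erase j, revealWeight θ (o k) else 0 else 0 := by
  rw [← Finset.mul_prod_erase _ _ (Finset.mem_univ i),
    ← Finset.mul_prod_erase _ _ (Finset.mem_erase.2 ⟨hij, Finset.mem_univ j⟩)]
  have h : ∀ k ∈ (univ.erase i).erase j,
      revealWeight (if k = i ∨ k = j then 0 else θ) (o k) = revealWeight θ (o k) := by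
    intro k hk
    simp only [Finset.mem_erase] at hk
    simp [hk.1, hk.2.1]
  rw [Finset.prod_congr rfl h]
  cases o i <;> cases o j <;> simp [revealWeight]

lemma jointSub_univ [Fintype V] [Fintype F] [DecidableEq 𝒳]
    (p : 𝒳 → ℝ) (Q : F → 𝒴 → (V → 𝒳) → ℝ) (R : 𝒵 → 𝒳 → ℝ) (θv : V → ℝ)
    (x : V → 𝒳) (y : F → 𝒴) (z : V → 𝒵 × Option 𝒳) :
    jointSub p Q R θv univ univ x y z =
      (∏ i, revealWeight (θv i) (z i).2) * strippedJoint p Q R y z x := by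
  have h : ∀ i, R (z i).1 (x i) * pert (θv i) (z i).2 (x i) = revealWeight (θv i) (z i).2 *
      if (z i).2 = none ∨ (z i).2 = some (x i) then R (z i).1 (x i) else 0 := by
    intro i
    cases (z i).2 <;> simp [pert, revealWeight, mul_comm]
  simp only [jointSub, strippedJoint, h, Finset.prod_mul_distrib]
  ring

variable [Fintype V] [Fintype F] [Fintype 𝒳] [Fintype 𝒴] [Fintype 𝒵]
  [DecidableEq V] [DecidableEq F] [DecidableEq 𝒳]

variable (p : 𝒳 → ℝ) (Q : F → 𝒴 → (V → 𝒳) → ℝ) (R : 𝒵 → 𝒳 → ℝ)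

lemma condEnt_eq_sum_revealWeight (θv : V → ℝ) :
    condEnt p Q R θv = ∑ y, ∑ z : V → 𝒵 × Option 𝒳,
      (∏ i, revealWeight (θv i) (z i).2) * entropyGap (strippedJoint p Q R y z) := by
  simp only [← entropyGap_const_mul]
  simp only [condEnt, jointSub_univ, entropyGap, Finset.sum_sub_distrib]
  congr 1
  rw [Finset.sum_comm]
  exact Finset.sum_congr rfl fun y _ => Finset.sum_comm

lemma condMI_eq_sum_pairMI (θv : V → ℝ) (i j : V) :
    condMI p Q R θv i j = ∑ y, ∑ z : V → 𝒵 × Option 𝒳,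
      (∏ k, revealWeight (θv k) (z k).2) * pairMI (strippedJoint p Q R y z) i j := by
  simp only [← pairMI_const_mul]
  simp only [condMI, jointSub_univ, pairMI]

/-- Mixed second difference of the conditional entropy in the parameters of the nodes
`i ≠ j`, as a conditional mutual information. -/
lemma condMI_eq_sum_revealSign {p : 𝒳 → ℝ} {Q : F → 𝒴 → (V → 𝒳) → ℝ} {R : 𝒵 → 𝒳 → ℝ}
    (hp : ∀ x, 0 ≤ p x) (hQ : ∀ a y x, 0 ≤ Q a y x) (hR : ∀ z x, 0 ≤ R z x)
    {i j : V} (hij : j ≠ i) (θ : ℝ) :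
    condMI p Q R (fun l => if l = i ∨ l = j then 0 else θ) i j =
      ∑ y, ∑ z : V → 𝒵 × Option 𝒳, revealSign (z i).2 * (revealSign (z j).2 *
        ∏ k ∈ (univ.erase i).erase j, revealWeight θ (z k).2) *
          entropyGap (strippedJoint p Q R y z) := by
  rw [condMI_eq_sum_pairMI]
  refine Finset.sum_congr rfl fun y _ => ?_
  conv_rhs => rw [sum_eq_sum_update_option j, sum_eq_sum_update_option i]
  refine Finset.sum_congr rfl fun z _ => ?_
  rw [prod_revealWeight_hidden hij θ fun k => (z k).2]
  by_cases hi : (z i).2 = none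
  · by_cases hj : (z j).2 = none
    · simp only [hi, hj, if_true, Function.update_of_ne hij]
      rw [← sum_revealSign_entropyGap_restrictAt (strippedJoint_nonneg hp hQ hR y z),
        Finset.mul_sum]
      refine Finset.sum_congr rfl fun a _ => ?_
      rw [Finset.mul_sum]
      refine Finset.sum_congr rfl fun b _ => ?_
      have hprod : ∏ k ∈ (univ.erase i).erase j, revealWeight θ
          (Function.update (Function.update z i ((z i).1, a)) j ((z j).1, b) k).2 =
          ∏ k ∈ (univ.erase i).erase j, revealWeight θ (z k).2 := by
        refine Finset.prod_congr rfl fun k hk => ?_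
        simp only [Finset.mem_erase] at hk
        rw [Function.update_of_ne hk.1, Function.update_of_ne hk.2.1]
      have hj' : Function.update z i ((z i).1, a) j = z j := Function.update_of_ne hij _ _
      rw [← strippedJoint_update p Q R y hi, ← strippedJoint_update p Q R y (hj' ▸ hj), hj',
        hprod,
        Function.update_self, Function.update_of_ne hij.symm, Function.update_self]
      ring
    · simp [hi, hj, Function.update_of_ne hij]
  · simp [hi]

end Observation

end Helpers

/-- second `θ`-derivative of the conditional entropy,
Eq. (3.3) of the paper.  For an observation system on a bipartite graph `G = (V,F,E)`,
the conditional entropy `H(X | Y, Z(θ))` is twice differentiable in `θ` with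
`d²/dθ² H(X | Y, Z(θ)) = ∑_{i ≠ j ∈ V} I(X_i ; X_j | Y, Z^{(ij)}(θ))`,
where `Z^{(ij)}(θ)` is obtained from `Z(θ)` by replacing `Z_l(θ)` with `(Z_l, ∗)` for
`l ∈ {i, j}` (equivalently, by setting the perturbation parameters of `i` and `j`
to `0`). -/
theorem statement_5 {V F 𝒳 𝒴 𝒵 : Type} [Fintype V] [DecidableEq V] [Fintype F]
    [DecidableEq F] [Fintype 𝒳] [DecidableEq 𝒳] [Fintype 𝒴] [DecidableEq 𝒴] [Fintype 𝒵]
    (p : 𝒳 → ℝ) (Q : F → 𝒴 → (V → 𝒳) → ℝ) (R : 𝒵 → 𝒳 → ℝ)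
    (hp : IsPdist p) (hQ : IsKernelQ Q) (hR : IsKernelR R)
    (g : V → F → Bool) (hQloc : QLocal g Q) (hQsym : QSym g Q)
    (θ : ℝ) (hθ : θ ∈ Set.Icc (0:ℝ) 1) :
    HasDerivAt (deriv fun t : ℝ => condEnt p Q R (fun _ => t))
      (∑ i : V, ∑ j ∈ Finset.univ.erase i,
        condMI p Q R (fun l => if l = i ∨ l = j then 0 else θ) i j) θ := by
  have h₁ : deriv (fun t : ℝ => condEnt p Q R (fun _ => t)) = fun t => ∑ y,
      ∑ z : V → 𝒵 × Option 𝒳, (∑ i, revealSign (z i).2 *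
        ∏ j ∈ univ.erase i, revealWeight t (z j).2) * entropyGap (strippedJoint p Q R y z) := by
    funext t
    simp only [condEnt_eq_sum_revealWeight]
    exact (HasDerivAt.fun_sum fun y _ => HasDerivAt.fun_sum fun z _ =>
      (hasDerivAt_prod_revealWeight univ (fun i => (z i).2) t).mul_const _).deriv
  have h₂ : ∑ i : V, ∑ j ∈ Finset.univ.erase i,
      condMI p Q R (fun l => if l = i ∨ l = j then 0 else θ) i j =
      ∑ y, ∑ z : V → 𝒵 × Option 𝒳, (∑ i, revealSign (z i).2 * ∑ j ∈ univ.erase i,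
        revealSign (z j).2 * ∏ k ∈ (univ.erase i).erase j, revealWeight θ (z k).2) *
          entropyGap (strippedJoint p Q R y z) := by
    simp only [Finset.mul_sum, Finset.sum_mul]
    rw [Finset.sum_congr rfl fun i _ => Finset.sum_congr rfl fun j hj =>
      condMI_eq_sum_revealSign hp.1 hQ.1 hR.1 (Finset.ne_of_mem_erase hj) θ]
    rw [Finset.sum_sigma' univ fun i => univ.erase i, Finset.sum_comm]
    refine Finset.sum_congr rfl fun y _ => ?_
    rw [Finset.sum_comm]
    refine Finset.sum_congr rfl fun z _ => ?_
    rw [Finset.sum_sigma']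
  rw [h₁, h₂]
  exact HasDerivAt.fun_sum fun y _ => HasDerivAt.fun_sum fun z _ =>
    (HasDerivAt.fun_sum fun i _ => (hasDerivAt_prod_revealWeight (univ.erase i)
      (fun i => (z i).2) θ).const_mul _).mul_const _

end PaperObs
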